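/- Let Q = [q_{ij}] be a real n×n signed row-stochastic matrix (∑_j |q_{ij}| = 1 for every i) with strictly positive diagonal entries q_{ii} > 0, which is irreducible (for every pair i, j there exists k ≥ 1 with (Q̃^k)_{ij} > 0) and structurally balanced (there exists s ∈ {−1,+1}^n with s_i q_{ij} s_j ≥ 0 for all i, j). Then every nonzero vector w ∈ ℝ^n with wᵀ Q = wᵀ has all entries nonzero: w_i ≠ 0 for every i. -/

import Mathlib

open Matrix Polynomial Filter

/-- The entrywise absolute value of a real matrix. -/
def absMat {ι : Type*} (M : Matrix ι ι ℝ) : Matrix ι ι ℝ :=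
  Matrix.of fun i j => |M i j|

/-- If every row of `absMat Q` sums to one, then the entrywise absolute value of a left fixed vector
of `Q` is a left fixed vector of `absMat Q`. -/
theorem abs_vecMul_absMat_of_vecMul_eq {ι : Type*} [Fintype ι] {Q : Matrix ι ι ℝ}
    (hrow : ∀ i, ∑ j, |Q i j| = 1) {w : ι → ℝ} (hw : w ᵥ* Q = w) :
    |w| ᵥ* absMat Q = |w| := by
  have hle : ∀ j ∈ Finset.univ, |w j| ≤ ∑ i, |w i| * |Q i j| := fun j _ => by
    calc |w j| = |∑ i, w i * Q i j| := by
          conv_lhs => rw [← hw]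
          rfl
      _ ≤ ∑ i, |w i * Q i j| := Finset.abs_sum_le_sum_abs _ _
      _ = ∑ i, |w i| * |Q i j| := by simp only [abs_mul]
  have hsum : ∑ j, |w j| = ∑ j, ∑ i, |w i| * |Q i j| := by
    rw [Finset.sum_comm]
    simp only [← Finset.mul_sum, hrow, mul_one]
  funext j
  exact ((Finset.sum_eq_sum_iff_of_le hle).1 hsum j (Finset.mem_univ j)).symm

/-- A left fixed vector of a square matrix is a left fixed vector of all its powers. -/
theorem vecMul_pow_eq_of_vecMul_eq {ι R : Type*} [Fintype ι] [DecidableEq ι] [Semiring R]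
    {M : Matrix ι ι R} {v : ι → R} (hv : v ᵥ* M = v) (k : ℕ) : v ᵥ* M ^ k = v := by
  induction k with
  | zero => simp
  | succ k ih => rw [pow_succ, ← vecMul_vecMul, ih, hv]

/-- The powers of an entrywise absolute value matrix have nonnegative entries. -/
theorem absMat_pow_nonneg {ι : Type*} [Fintype ι] [DecidableEq ι] (Q : Matrix ι ι ℝ) (k : ℕ)
    (i j : ι) : 0 ≤ (absMat Q ^ k) i j := by
  induction k generalizing j with
  | zero =>
    rw [pow_zero, one_apply]
    split_ifs <;> norm_num
  | succ k ih =>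
    rw [pow_succ, mul_apply]
    exact Finset.sum_nonneg fun l _ => mul_nonneg (ih l) (abs_nonneg _)

/-- For a signed row-stochastic, irreducible, structurally balanced matrix
with positive diagonal, every nonzero left fixed vector (`wᵀ Q = wᵀ`) has all
entries nonzero. -/
theorem left_eigvec_entries_nonzero {n : ℕ}
    (Q : Matrix (Fin n) (Fin n) ℝ)
    (hrow : ∀ i, ∑ j, |Q i j| = 1)
    (hdiag : ∀ i, 0 < Q i i)
    (hirr : ∀ i j, ∃ k, 1 ≤ k ∧ 0 < ((absMat Q) ^ k) i j)
    (hsb : ∃ s : Fin n → ℝ, (∀ i, s i = 1 ∨ s i = -1) ∧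
      ∀ i j, 0 ≤ s i * Q i j * s j) :
    ∀ w : Fin n → ℝ, w ≠ 0 → Matrix.vecMul w Q = w → ∀ i, w i ≠ 0 := by
  intro w hw0 hw i hi
  obtain ⟨j, hj⟩ := Function.ne_iff.1 hw0
  obtain ⟨k, -, hk⟩ := hirr j i
  have hfix : ∑ l, |w l| * (absMat Q ^ k) l i = |w i| :=
    congrFun (vecMul_pow_eq_of_vecMul_eq (abs_vecMul_absMat_of_vecMul_eq hrow hw) k) i
  have hpos : 0 < ∑ l, |w l| * (absMat Q ^ k) l i :=
    Finset.sum_pos' (fun l _ => mul_nonneg (abs_nonneg _) (absMat_pow_nonneg Q k l i))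
      ⟨j, Finset.mem_univ j, mul_pos (abs_pos.2 hj) hk⟩
  rw [hfix, hi, abs_zero] at hpos
  exact hpos.false
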